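/- arXiv:1410.2327 — 7 statements merged into one kernel-verified Lean document; each statement's English description precedes it below -/
import Mathlib

section
/- Let E be a real inner product space (e.g., EuclideanSpace ℝ (Fin p)). For every R > 0, every anchor position a ∈ E, and every r ∈ ℝ, the function x ↦ h_R(max(0, ‖x − a‖ − r)) is convex on E. -/
/-- The Huber loss function with parameter `R`. -/
noncomputable def huber (R t : ℝ) : ℝ :=
  if |t| ≤ R then t ^ 2 else 2 * R * |t| - R ^ 2

/-- The Huber loss lies above each of the affine functions `t ↦ 2ct - c²` with `|c| ≤ R`. -/
theorem affine_le_huber {R c : ℝ} (hc : |c| ≤ R) (t : ℝ) : 2 * c * t - c ^ 2 ≤ huber R t := by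
  unfold huber
  split_ifs with h
  · nlinarith [sq_nonneg (t - c)]
  · have hct : c * t ≤ |c| * |t| := (le_abs_self _).trans (abs_mul c t).le
    nlinarith [sq_abs c]

/-- At a nonnegative point, the Huber loss is attained by one of the nondecreasing affine
functions `t ↦ 2ct - c²` with `0 ≤ c ≤ R`. -/
theorem exists_huber_eq_affine {R t : ℝ} (hR : 0 ≤ R) (ht : 0 ≤ t) :
    ∃ c, 0 ≤ c ∧ c ≤ R ∧ huber R t = 2 * c * t - c ^ 2 := by
  unfold huber
  rw [abs_of_nonneg ht]
  split_ifs with h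
  · exact ⟨t, ht, h, by ring⟩
  · exact ⟨R, hR, le_rfl, rfl⟩

/-- The Huber loss of a nonnegative convex function is convex. -/
theorem ConvexOn.huber_comp {E : Type*} [AddCommMonoid E] [SMul ℝ E] {s : Set E} {f : E → ℝ}
    {R : ℝ} (hR : 0 ≤ R) (hf : ConvexOn ℝ s f) (hf₀ : ∀ x ∈ s, 0 ≤ f x) :
    ConvexOn ℝ s (fun x => huber R (f x)) := by
  refine ⟨hf.1, fun x hx y hy p q hp hq hpq => ?_⟩
  obtain ⟨c, hc₀, hcR, hc⟩ := exists_huber_eq_affine hR (hf₀ _ (hf.1 hx hy hp hq hpq))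
  have hc_abs : |c| ≤ R := by rwa [abs_of_nonneg hc₀]
  have hfxy := hf.2 hx hy hp hq hpq
  simp only [smul_eq_mul] at hfxy ⊢
  calc huber R (f (p • x + q • y)) = 2 * c * f (p • x + q • y) - c ^ 2 := hc
    _ ≤ 2 * c * (p * f x + q * f y) - c ^ 2 := by gcongr
    _ = p * (2 * c * f x - c ^ 2) + q * (2 * c * f y - c ^ 2) := by
      linear_combination c ^ 2 * hpq
    _ ≤ p * huber R (f x) + q * huber R (f y) := by
      gcongr <;> exact affine_le_huber hc_abs _

/-- Let `E` be a real inner product space. For every `R > 0`, anchor `a ∈ E`, and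
`r ∈ ℝ`, the function `x ↦ h_R(max(0, ‖x − a‖ − r))` is convex on `E`. -/
theorem huber_hinge_anchor_convexOn
    {E : Type*} [NormedAddCommGroup E] [InnerProductSpace ℝ E]
    (R : ℝ) (hR : 0 < R) (a : E) (r : ℝ) :
    ConvexOn ℝ Set.univ (fun x : E => huber R (max 0 (‖x - a‖ - r))) := by
  have hdist : ConvexOn ℝ Set.univ (fun x : E => ‖x - a‖ - r) := by
    simp only [← dist_eq_norm, sub_eq_add_neg _ r]
    exact (convexOn_univ_dist a).add_const (-r)
  exact ((convexOn_const 0 convex_univ).sup hdist).huber_comp hR.le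
    fun x _ => le_max_left _ _
end

section
/- Let E be a real inner product space (e.g., EuclideanSpace ℝ (Fin p)). For every R > 0 and every d ∈ ℝ, the function (x, y) ↦ h_R(max(0, ‖x − y‖ − d)) is jointly convex on E × E. -/
theorem two_mul_sub_sq_le_huber {R m : ℝ} (hm : |m| ≤ R) (t : ℝ) :
    2 * m * t - m ^ 2 ≤ huber R t := by
  unfold huber
  split_ifs with h
  · nlinarith [sq_nonneg (t - m)]
  · have hmt : m * t ≤ |m| * |t| := (le_abs_self _).trans (abs_mul m t).le
    nlinarith [mul_nonneg (sub_nonneg.2 hm) (sub_nonneg.2 (not_le.1 h).le), sq_abs m,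
      mul_nonneg (sub_nonneg.2 hm) (sub_nonneg.2 (hm.trans (not_le.1 h).le))]

theorem exists_huber_eq {R : ℝ} (hR : 0 ≤ R) (t : ℝ) :
    ∃ m, |m| ≤ R ∧ huber R t = 2 * m * t - m ^ 2 := by
  unfold huber
  split_ifs with h
  · exact ⟨t, h, by ring⟩
  · rcases abs_cases t with ⟨ht, -⟩ | ⟨ht, -⟩
    · exact ⟨R, (abs_of_nonneg hR).le, by rw [ht]⟩
    · exact ⟨-R, by rw [abs_neg, abs_of_nonneg hR], by rw [ht]; ring⟩

theorem convexOn_huber {R : ℝ} (hR : 0 ≤ R) : ConvexOn ℝ Set.univ (huber R) := by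
  refine ⟨convex_univ, fun x _ y _ a b ha hb hab => ?_⟩
  obtain ⟨m, hm, h⟩ := exists_huber_eq hR (a • x + b • y)
  rw [h]
  simp only [smul_eq_mul]
  have hx := mul_le_mul_of_nonneg_left (two_mul_sub_sq_le_huber hm x) ha
  have hy := mul_le_mul_of_nonneg_left (two_mul_sub_sq_le_huber hm y) hb
  obtain rfl : b = 1 - a := by linarith
  linarith

theorem monotoneOn_huber {R : ℝ} (hR : 0 ≤ R) : MonotoneOn (huber R) (Set.Ici 0) := by
  intro x hx y hy hxy
  simp only [Set.mem_Ici] at hx hy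
  unfold huber
  rw [abs_of_nonneg hx, abs_of_nonneg hy]
  split_ifs <;> nlinarith [sq_nonneg (x - R)]

/-- Let `E` be a real inner product space. For every `R > 0` and `d ∈ ℝ`, the
function `(x, y) ↦ h_R(max(0, ‖x − y‖ − d))` is jointly convex on `E × E`. -/
theorem huber_hinge_pair_convexOn
    {E : Type*} [NormedAddCommGroup E] [InnerProductSpace ℝ E]
    (R : ℝ) (hR : 0 < R) (d : ℝ) :
    ConvexOn ℝ Set.univ (fun p : E × E => huber R (max 0 (‖p.1 - p.2‖ - d))) := by
  have hnorm : ConvexOn ℝ Set.univ (fun p : E × E => ‖p.1 - p.2‖) :=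
    convexOn_univ_norm.comp_linearMap (LinearMap.fst ℝ E E - LinearMap.snd ℝ E E)
  have hhinge : ConvexOn ℝ Set.univ (fun p : E × E => max 0 (‖p.1 - p.2‖ - d)) :=
    (convexOn_const 0 convex_univ).sup (hnorm.sub (concaveOn_const d convex_univ))
  refine ⟨convex_univ, fun x _ y _ a b ha hb hab => ?_⟩
  have hle := hhinge.2 (Set.mem_univ x) (Set.mem_univ y) ha hb hab
  have h0 := le_max_left 0 (‖(a • x + b • y).1 - (a • x + b • y).2‖ - d)
  exact (monotoneOn_huber hR.le h0 (h0.trans hle) hle).trans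
    ((convexOn_huber hR.le).2 (Set.mem_univ _) (Set.mem_univ _) ha hb hab)
end

section
/- Let E be a nontrivial real inner product space (e.g., EuclideanSpace ℝ (Fin p) with p ≥ 1). For every R > 0 and every d > 0, the function g : E → ℝ, g(x) = h_R(‖x‖ − d), is not convex. -/
theorem huber_zero {R : ℝ} (hR : 0 < R) : huber R 0 = 0 := by
  simp [huber, hR.le]

theorem huber_pos {R t : ℝ} (hR : 0 < R) (ht : t ≠ 0) : 0 < huber R t := by
  unfold huber
  split_ifs with h
  · positivity
  · nlinarith

/-- Let `E` be a nontrivial real inner product space. For every `R > 0` and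
`d > 0`, the function `x ↦ h_R(‖x‖ − d)` is not convex. -/
theorem huber_dist_not_convexOn
    {E : Type*} [NormedAddCommGroup E] [InnerProductSpace ℝ E] [Nontrivial E]
    (R : ℝ) (hR : 0 < R) (d : ℝ) (hd : 0 < d) :
    ¬ ConvexOn ℝ Set.univ (fun x : E => huber R (‖x‖ - d)) := by
  intro h
  obtain ⟨x, hx⟩ := exists_norm_eq E hd.le
  have hmid := h.2 (Set.mem_univ x) (Set.mem_univ (-x))
    (by norm_num : (0 : ℝ) ≤ 1 / 2) (by norm_num : (0 : ℝ) ≤ 1 / 2) (by norm_num)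
  simp only [smul_neg, add_neg_cancel, norm_neg, norm_zero, hx, sub_self, zero_sub,
    huber_zero hR, smul_zero, add_zero] at hmid
  exact (huber_pos hR (neg_ne_zero.mpr hd.ne')).not_ge hmid
end

section
/- Let E be a real inner product space of dimension at least 1 (e.g., EuclideanSpace ℝ (Fin p) with p ≥ 1), let h : ℝ → ℝ be convex and even with h(0) = 0, and let d ≥ 0. Define g(x) = h(‖x‖ − d) and f(x) = h(max(0, ‖x‖ − d)). Then f is the convex envelope of g on E: f is convex, f(x) ≤ g(x) for all x ∈ E, and for every convex function η : E → ℝ satisfying η(x) ≤ g(x) for all x ∈ E, one has η(x) ≤ f(x) for all x ∈ E. -/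
/-- An even convex function is monotone on the nonnegative reals. -/
theorem ConvexOn.monotoneOn_Ici_of_even {h : ℝ → ℝ} (hconv : ConvexOn ℝ Set.univ h)
    (heven : ∀ t : ℝ, h (-t) = h t) : MonotoneOn h (Set.Ici 0) := by
  intro s hs t _ hst
  have hseg : s ∈ segment ℝ (-t) t := by
    rw [segment_eq_Icc (by linarith [Set.mem_Ici.mp hs])]
    exact ⟨by linarith [Set.mem_Ici.mp hs], hst⟩
  simpa [heven] using hconv.le_on_segment (Set.mem_univ _) (Set.mem_univ _) hseg

/-- A convex function on a nontrivial real normed space that is bounded above by `c` on a sphere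
centered at the origin is bounded above by `c` on the closed ball it bounds. -/
theorem ConvexOn.le_on_closedBall_of_le_on_sphere {E : Type*} [NormedAddCommGroup E]
    [NormedSpace ℝ E] [Nontrivial E] {η : E → ℝ} (hη : ConvexOn ℝ Set.univ η) {c r : ℝ}
    (hr : 0 ≤ r) (hle : ∀ y : E, ‖y‖ = r → η y ≤ c) {x : E} (hx : ‖x‖ ≤ r) : η x ≤ c := by
  have hsub : convexHull ℝ (Metric.sphere (0 : E) r) ⊆ {y ∈ Set.univ | η y ≤ c} :=
    convexHull_min (fun y hy => ⟨Set.mem_univ y, hle y (mem_sphere_zero_iff_norm.mp hy)⟩)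
      (hη.convex_le c)
  rw [convexHull_sphere_eq_closedBall 0 hr] at hsub
  exact (hsub (mem_closedBall_zero_iff.mpr hx)).2


/-- Let `E` be a real inner product space of dimension at least 1, `h : ℝ → ℝ`
convex and even with `h(0) = 0`, and `d ≥ 0`. Then `f(x) = h(max(0, ‖x‖ − d))`
is the convex envelope of `g(x) = h(‖x‖ − d)`: `f` is convex, `f ≤ g`, and any
convex underestimator `η` of `g` satisfies `η ≤ f`. -/
theorem hinge_comp_is_convex_envelope
    {E : Type*} [NormedAddCommGroup E] [InnerProductSpace ℝ E] [Nontrivial E]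
    (h : ℝ → ℝ) (hconv : ConvexOn ℝ Set.univ h) (heven : ∀ t : ℝ, h (-t) = h t)
    (h0 : h 0 = 0) (d : ℝ) (hd : 0 ≤ d) :
    ConvexOn ℝ Set.univ (fun x : E => h (max 0 (‖x‖ - d))) ∧
    (∀ x : E, h (max 0 (‖x‖ - d)) ≤ h (‖x‖ - d)) ∧
    (∀ η : E → ℝ, ConvexOn ℝ Set.univ η → (∀ x : E, η x ≤ h (‖x‖ - d)) →
      ∀ x : E, η x ≤ h (max 0 (‖x‖ - d))) := by
  have hmono := hconv.monotoneOn_Ici_of_even heven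
  refine ⟨?_, fun x => ?_, fun η hη hle x => ?_⟩
  · have hhinge : ConvexOn ℝ Set.univ (fun x : E => max 0 (‖x‖ - d)) :=
      (convexOn_const 0 convex_univ).sup (convexOn_univ_norm.sub (concaveOn_const d convex_univ))
    refine ⟨convex_univ, fun x _ y _ a b ha hb hab => ?_⟩
    refine (hmono (Set.mem_Ici.mpr (le_max_left _ _)) ?_ (hhinge.2 trivial trivial ha hb hab)).trans
      (hconv.2 trivial trivial ha hb hab)
    simp only [smul_eq_mul, Set.mem_Ici]
    positivity
  · rcases le_total (‖x‖ - d) 0 with hx | hx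
    · rw [max_eq_left hx, ← heven (‖x‖ - d)]
      exact hmono Set.self_mem_Ici (neg_nonneg.mpr hx) (neg_nonneg.mpr hx)
    · rw [max_eq_right hx]
  · rcases le_total (‖x‖ - d) 0 with hx | hx
    · rw [max_eq_left hx]
      refine hη.le_on_closedBall_of_le_on_sphere hd (fun y hy => ?_) (sub_nonpos.mp hx)
      simpa [hy] using hle y
    · rw [max_eq_right hx]
      exact hle x
end

section
/- Let E be a real inner product space of dimension at least 1 (e.g., EuclideanSpace ℝ (Fin p) with p ≥ 1), let R > 0 and d ≥ 0. Define g(x) = h_R(‖x‖ − d) and f(x) = h_R(max(0, ‖x‖ − d)). Then f is the convex envelope of g on E: f is convex, f(x) ≤ g(x) for all x ∈ E with equality whenever ‖x‖ ≥ d, and for every convex function η : E → ℝ satisfying η(x) ≤ g(x) for all x ∈ E, one has η(x) ≤ f(x) for all x ∈ E. -/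
theorem huber_eq_zero_of_max {R t : ℝ} (hR : 0 < R) (ht : t ≤ 0) : huber R (max 0 t) = 0 := by
  simp [huber, max_eq_left ht, hR.le]

/-- Affine functions of slope `2 * a` with `a ∈ [0, R]` minorize the hinged Huber function. -/
theorem affine_le_huber_max {R a : ℝ} (ha : 0 ≤ a) (haR : a ≤ R) (t : ℝ) :
    2 * a * t - a ^ 2 ≤ huber R (max 0 t) := by
  have h0 : 0 ≤ max 0 t := le_max_left _ _
  have ht : t ≤ max 0 t := le_max_right _ _
  have hat : a * t ≤ a * max 0 t := mul_le_mul_of_nonneg_left ht ha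
  unfold huber
  rw [abs_of_nonneg h0]
  split_ifs with h
  · nlinarith [sq_nonneg (max 0 t - a)]
  · push Not at h
    nlinarith [mul_nonneg (sub_nonneg.2 haR) (sub_nonneg.2 h.le), sq_nonneg (R - a)]

/-- The hinged Huber function attains one of its affine minorants at every point. -/
theorem exists_huber_max_eq_affine {R : ℝ} (hR : 0 < R) (t : ℝ) :
    ∃ a, 0 ≤ a ∧ a ≤ R ∧ huber R (max 0 t) = 2 * a * t - a ^ 2 := by
  rcases le_total t 0 with ht | ht
  · exact ⟨0, le_rfl, hR.le, by simp [huber_eq_zero_of_max hR ht]⟩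
  · rw [max_eq_right ht]
    unfold huber
    rw [abs_of_nonneg ht]
    split_ifs with h
    · exact ⟨t, ht, h, by ring⟩
    · exact ⟨R, hR.le, le_rfl, rfl⟩

theorem huber_nonneg {R : ℝ} (hR : 0 < R) (t : ℝ) : 0 ≤ huber R t := by
  unfold huber
  split_ifs with h
  · positivity
  · push Not at h
    nlinarith

theorem convexOn_huber_max_norm_sub {E : Type*} [SeminormedAddCommGroup E] [NormedSpace ℝ E]
    {R : ℝ} (hR : 0 < R) (d : ℝ) :
    ConvexOn ℝ Set.univ (fun x : E => huber R (max 0 (‖x‖ - d))) := by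
  refine ⟨convex_univ, fun x _ y _ α β hα hβ hαβ => ?_⟩
  obtain ⟨a, ha, haR, h⟩ := exists_huber_max_eq_affine hR (‖α • x + β • y‖ - d)
  have hnorm : ‖α • x + β • y‖ ≤ α * ‖x‖ + β * ‖y‖ := by
    simpa [norm_smul, abs_of_nonneg hα, abs_of_nonneg hβ] using norm_add_le (α • x) (β • y)
  simp only [smul_eq_mul]
  calc huber R (max 0 (‖α • x + β • y‖ - d))
      = 2 * a * (‖α • x + β • y‖ - d) - a ^ 2 := h
    _ ≤ 2 * a * (α * ‖x‖ + β * ‖y‖ - d) - a ^ 2 := by gcongr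
    _ = α * (2 * a * (‖x‖ - d) - a ^ 2) + β * (2 * a * (‖y‖ - d) - a ^ 2) := by
      linear_combination (2 * a * d + a ^ 2) * hαβ
    _ ≤ _ := by
      gcongr <;> exact affine_le_huber_max ha haR _

theorem exists_norm_eq_one_and_norm_smul_eq {E : Type*} [NormedAddCommGroup E] [NormedSpace ℝ E]
    [Nontrivial E] (x : E) : ∃ u : E, ‖u‖ = 1 ∧ ‖x‖ • u = x := by
  rcases eq_or_ne x 0 with rfl | hx
  · obtain ⟨u, hu⟩ := exists_norm_eq E zero_le_one
    exact ⟨u, hu, by simp⟩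
  · have hx' : ‖x‖ ≠ 0 := norm_ne_zero_iff.2 hx
    exact ⟨‖x‖⁻¹ • x, by simp [norm_smul, hx'], by simp [smul_smul, hx']⟩

/-- A convex function that is nonpositive on a sphere around the origin is nonpositive on the
ball it bounds. -/
theorem ConvexOn.nonpos_of_norm_lt {E : Type*} [NormedAddCommGroup E] [NormedSpace ℝ E]
    [Nontrivial E] {η : E → ℝ} (hη : ConvexOn ℝ Set.univ η) {d : ℝ}
    (h : ∀ y : E, ‖y‖ = d → η y ≤ 0) {x : E} (hx : ‖x‖ < d) : η x ≤ 0 := by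
  have hd : 0 < d := (norm_nonneg x).trans_lt hx
  obtain ⟨u, hu, hxu⟩ := exists_norm_eq_one_and_norm_smul_eq x
  have hα : 0 ≤ (d + ‖x‖) / (2 * d) := by positivity
  have hβ : 0 ≤ (d - ‖x‖) / (2 * d) := div_nonneg (by linarith) (by linarith)
  have hsum : (d + ‖x‖) / (2 * d) + (d - ‖x‖) / (2 * d) = 1 := by field_simp; ring
  have hcomb : ((d + ‖x‖) / (2 * d)) • (d • u) + ((d - ‖x‖) / (2 * d)) • (-(d • u)) = x := by
    rw [smul_neg, smul_smul, smul_smul, ← sub_eq_add_neg, ← sub_smul]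
    convert hxu using 2
    field_simp
    ring
  have hle := hη.2 (Set.mem_univ (d • u)) (Set.mem_univ (-(d • u))) hα hβ hsum
  rw [hcomb, smul_eq_mul, smul_eq_mul] at hle
  have hn : ‖d • u‖ = d := by simp [norm_smul, hu, abs_of_pos hd]
  linarith [mul_nonpos_of_nonneg_of_nonpos hα (h _ hn),
    mul_nonpos_of_nonneg_of_nonpos hβ (h (-(d • u)) (by rw [norm_neg, hn]))]

/-- Let `E` be a real inner product space of dimension at least 1, `R > 0` and
`d ≥ 0`. Then `f(x) = h_R(max(0, ‖x‖ − d))` is the convex envelope of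
`g(x) = h_R(‖x‖ − d)`: `f` is convex, `f ≤ g` with equality whenever `‖x‖ ≥ d`,
and any convex underestimator `η` of `g` satisfies `η ≤ f`. -/
theorem huber_hinge_is_convex_envelope
    {E : Type*} [NormedAddCommGroup E] [InnerProductSpace ℝ E] [Nontrivial E]
    (R : ℝ) (hR : 0 < R) (d : ℝ) (hd : 0 ≤ d) :
    ConvexOn ℝ Set.univ (fun x : E => huber R (max 0 (‖x‖ - d))) ∧
    (∀ x : E, huber R (max 0 (‖x‖ - d)) ≤ huber R (‖x‖ - d)) ∧
    (∀ x : E, d ≤ ‖x‖ → huber R (max 0 (‖x‖ - d)) = huber R (‖x‖ - d)) ∧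
    (∀ η : E → ℝ, ConvexOn ℝ Set.univ η → (∀ x : E, η x ≤ huber R (‖x‖ - d)) →
      ∀ x : E, η x ≤ huber R (max 0 (‖x‖ - d))) := by
  have heq : ∀ x : E, d ≤ ‖x‖ → huber R (max 0 (‖x‖ - d)) = huber R (‖x‖ - d) := fun x hx => by
    rw [max_eq_right (sub_nonneg.2 hx)]
  refine ⟨convexOn_huber_max_norm_sub hR d, fun x => ?_, heq, fun η hη hle x => ?_⟩
  · rcases le_total d ‖x‖ with hx | hx
    · exact (heq x hx).le
    · rw [huber_eq_zero_of_max hR (sub_nonpos.2 hx)]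
      exact huber_nonneg hR _
  · rcases le_or_gt d ‖x‖ with hx | hx
    · exact (hle x).trans (heq x hx).ge
    · rw [huber_eq_zero_of_max hR (sub_nonpos.2 hx.le)]
      refine hη.nonpos_of_norm_lt (fun y hy => (hle y).trans ?_) hx
      simp [huber, hy, hR.le]
end

section
/- Let E be a real inner product space of dimension at least 1 (e.g., EuclideanSpace ℝ (Fin p) with p ≥ 1) and let d ≥ 0. Define g(x) = (‖x‖ − d)² and f(x) = (max(0, ‖x‖ − d))². Then f is the convex envelope of g on E: f is convex, f(x) ≤ g(x) for all x ∈ E with equality whenever ‖x‖ ≥ d, and for every convex function η : E → ℝ satisfying η(x) ≤ g(x) for all x ∈ E, one has η(x) ≤ f(x) for all x ∈ E. -/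
/-- Let `E` be a real inner product space of dimension at least 1 and `d ≥ 0`.
Then `f(x) = (max(0, ‖x‖ − d))²` is the convex envelope of `g(x) = (‖x‖ − d)²`:
`f` is convex, `f ≤ g` with equality whenever `‖x‖ ≥ d`, and any convex
underestimator `η` of `g` satisfies `η ≤ f`. -/
theorem sq_hinge_is_convex_envelope
    {E : Type*} [NormedAddCommGroup E] [InnerProductSpace ℝ E] [Nontrivial E]
    (d : ℝ) (hd : 0 ≤ d) :
    ConvexOn ℝ Set.univ (fun x : E => (max 0 (‖x‖ - d)) ^ 2) ∧
    (∀ x : E, (max 0 (‖x‖ - d)) ^ 2 ≤ (‖x‖ - d) ^ 2) ∧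
    (∀ x : E, d ≤ ‖x‖ → (max 0 (‖x‖ - d)) ^ 2 = (‖x‖ - d) ^ 2) ∧
    (∀ η : E → ℝ, ConvexOn ℝ Set.univ η → (∀ x : E, η x ≤ (‖x‖ - d) ^ 2) →
      ∀ x : E, η x ≤ (max 0 (‖x‖ - d)) ^ 2) := by
  refine ⟨?_, fun x => ?_, fun x hx => ?_, fun η hη hle x => ?_⟩
  · have h : ConvexOn ℝ Set.univ (fun x : E => max 0 (‖x‖ - d)) :=
      (convexOn_const 0 convex_univ).sup (convexOn_univ_norm.sub (concaveOn_const d convex_univ))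
    exact h.pow (fun x _ => le_max_left _ _) 2
  · rcases max_choice 0 (‖x‖ - d) with h | h
    · simpa [h] using sq_nonneg (‖x‖ - d)
    · rw [h]
  · rw [max_eq_right (sub_nonneg.2 hx)]
  · rcases le_total d ‖x‖ with hx | hx
    · rw [max_eq_right (sub_nonneg.2 hx)]
      exact hle x
    · have hmem : x ∈ convexHull ℝ (Metric.sphere (0 : E) d) := by
        rw [convexHull_sphere_eq_closedBall 0 hd]
        simpa using hx
      obtain ⟨y, hy, hxy⟩ := hη.exists_ge_of_mem_convexHull (Set.subset_univ _) hmem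
      have hyd : ‖y‖ = d := by simpa using hy
      calc η x ≤ η y := hxy
        _ ≤ (‖y‖ - d) ^ 2 := hle y
        _ = 0 := by simp [hyd]
        _ ≤ _ := sq_nonneg _
end

section
/- Let E be a real inner product space of dimension at least 1 (e.g., EuclideanSpace ℝ (Fin p) with p ≥ 1) and let d ≥ 0. Define g(x) = |‖x‖ − d| and f(x) = max(0, ‖x‖ − d). Then f is the convex envelope of g on E: f is convex, f(x) ≤ g(x) for all x ∈ E with equality whenever ‖x‖ ≥ d, and for every convex function η : E → ℝ satisfying η(x) ≤ g(x) for all x ∈ E, one has η(x) ≤ f(x) for all x ∈ E. -/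
/-- Let `E` be a real inner product space of dimension at least 1 and `d ≥ 0`.
Then `f(x) = max(0, ‖x‖ − d)` is the convex envelope of `g(x) = |‖x‖ − d|`:
`f` is convex, `f ≤ g` with equality whenever `‖x‖ ≥ d`, and any convex
underestimator `η` of `g` satisfies `η ≤ f`. -/
theorem hinge_is_convex_envelope_of_abs
    {E : Type*} [NormedAddCommGroup E] [InnerProductSpace ℝ E] [Nontrivial E]
    (d : ℝ) (hd : 0 ≤ d) :
    ConvexOn ℝ Set.univ (fun x : E => max 0 (‖x‖ - d)) ∧
    (∀ x : E, max 0 (‖x‖ - d) ≤ |‖x‖ - d|) ∧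
    (∀ x : E, d ≤ ‖x‖ → max 0 (‖x‖ - d) = |‖x‖ - d|) ∧
    (∀ η : E → ℝ, ConvexOn ℝ Set.univ η → (∀ x : E, η x ≤ |‖x‖ - d|) →
      ∀ x : E, η x ≤ max 0 (‖x‖ - d)) := by
  refine ⟨?_, fun x => max_le (abs_nonneg _) (le_abs_self _), fun x hx => ?_, fun η hη hle x => ?_⟩
  · exact (convexOn_const 0 convex_univ).sup (convexOn_univ_norm.add_const (-d))
  · rw [abs_of_nonneg (sub_nonneg.2 hx), max_eq_right (sub_nonneg.2 hx)]
  · rcases le_total d ‖x‖ with hx | hx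
    · exact (hle x).trans (by rw [abs_of_nonneg (sub_nonneg.2 hx)]; exact le_max_right _ _)
    · have hsub : convexHull ℝ (Metric.sphere (0 : E) d) ⊆ {y ∈ Set.univ | η y ≤ 0} :=
        convexHull_min (fun y hy => ⟨trivial, by simpa [mem_sphere_zero_iff_norm.1 hy] using hle y⟩)
          (hη.convex_le 0)
      rw [convexHull_sphere_eq_closedBall (0 : E) hd] at hsub
      exact (hsub (mem_closedBall_zero_iff.2 hx)).2.trans (le_max_left _ _)
end
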